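/- arXiv:1112.0388 — 3 statements merged into one kernel-verified Lean document; each statement's English description precedes it below -/
import Mathlib

section
/- Let D ⊆ ℂ^n be a bounded open set and let f : D → ℂ be a holomorphic function that is bounded on D. For Q = (Q_0, …, Q_{N−1}) ∈ ℂ^N define 𝒲_Q : D → ℂ by 𝒲_Q(ζ) := f(ζ) + Σ_{i=0}^{N−1} Q_i·f(ζ)^i. Then there exists ε > 0 such that for every Q ∈ ℂ^N with ‖Q‖ < ε, the function 𝒲_Q has the same set of critical points in D as f; that is, for every ζ ∈ D, the derivative of 𝒲_Q at ζ vanishes if and only if the derivative of f at ζ vanishes. -/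
/-- The derivative of the polynomial perturbation `w ↦ w + ∑ Q_i w^i` of the identity. -/
theorem hasDerivAt_add_sum_mul_pow {N : ℕ} (Q : Fin N → ℂ) (w : ℂ) :
    HasDerivAt (fun w : ℂ => w + ∑ i : Fin N, Q i * w ^ (i : ℕ))
      (1 + ∑ i : Fin N, Q i * ((i : ℕ) * w ^ ((i : ℕ) - 1))) w :=
  (hasDerivAt_id' w).add <| HasDerivAt.fun_sum fun i _ => (hasDerivAt_pow (i : ℕ) w).const_mul (Q i)

/-- For small `Q`, the derivative of `w ↦ w + ∑ Q_i w^i` has no zero with `‖w‖ ≤ R`. -/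
theorem one_add_sum_mul_pow_ne_zero {N : ℕ} (Q : Fin N → ℂ) {w : ℂ} {R : ℝ} (hw : ‖w‖ ≤ R)
    (hQ : ‖Q‖ < 1 / (1 + ∑ i : Fin N, (i : ℝ) * R ^ ((i : ℕ) - 1))) :
    1 + ∑ i : Fin N, Q i * ((i : ℕ) * w ^ ((i : ℕ) - 1)) ≠ 0 := by
  have hR : 0 ≤ R := (norm_nonneg w).trans hw
  have hS : 0 ≤ ∑ i : Fin N, (i : ℝ) * R ^ ((i : ℕ) - 1) :=
    Finset.sum_nonneg fun i _ => by positivity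
  have hle : ‖∑ i : Fin N, Q i * ((i : ℕ) * w ^ ((i : ℕ) - 1))‖ ≤
      ‖Q‖ * ∑ i : Fin N, (i : ℝ) * R ^ ((i : ℕ) - 1) := by
    rw [Finset.mul_sum]
    refine norm_sum_le_of_le _ fun i _ => ?_
    rw [norm_mul, norm_mul, norm_pow, Complex.norm_natCast]
    gcongr
    exact norm_le_pi_norm Q i
  rw [lt_div_iff₀ (by positivity)] at hQ
  intro h
  rw [add_comm, ← eq_neg_iff_add_eq_zero] at h
  rw [h, norm_neg, norm_one] at hle
  linarith [norm_nonneg Q]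

/-- Proposition 4.6: if `f` is holomorphic and bounded on a bounded open set
`D ⊆ ℂⁿ`, then for all sufficiently small parameters `Q ∈ ℂᴺ` the unfolding
`𝒲_Q(ζ) = f(ζ) + ∑_{i<N} Q_i f(ζ)^i` has the same critical points in `D` as `f`. -/
theorem unfolding_same_critical_points (n N : ℕ)
    (D : Set (Fin n → ℂ)) (hDopen : IsOpen D) (hDbdd : Bornology.IsBounded D)
    (f : (Fin n → ℂ) → ℂ) (hf : DifferentiableOn ℂ f D)
    (hfbdd : ∃ C : ℝ, ∀ z ∈ D, ‖f z‖ ≤ C) :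
    ∃ ε > (0 : ℝ), ∀ Q : Fin N → ℂ, ‖Q‖ < ε → ∀ ζ ∈ D,
      (fderiv ℂ (fun z => f z + ∑ i : Fin N, Q i * (f z) ^ (i : ℕ)) ζ = 0 ↔
        fderiv ℂ f ζ = 0) := by
  obtain ⟨C, hC⟩ := hfbdd
  have hSC : 0 ≤ ∑ i : Fin N, (i : ℝ) * |C| ^ ((i : ℕ) - 1) :=
    Finset.sum_nonneg fun i _ => by positivity
  refine ⟨1 / (1 + ∑ i : Fin N, (i : ℝ) * |C| ^ ((i : ℕ) - 1)), by positivity, ?_⟩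
  intro Q hQ ζ hζ
  have hfζ : HasFDerivAt f (fderiv ℂ f ζ) ζ :=
    (hf.differentiableAt (hDopen.mem_nhds hζ)).hasFDerivAt
  have hne := one_add_sum_mul_pow_ne_zero Q ((hC ζ hζ).trans (le_abs_self C)) hQ
  have hW := (hasDerivAt_add_sum_mul_pow Q (f ζ)).comp_hasFDerivAt ζ hfζ
  have hW' : fderiv ℂ (fun z => f z + ∑ i : Fin N, Q i * (f z) ^ (i : ℕ)) ζ =
      (1 + ∑ i : Fin N, Q i * ((i : ℕ) * f ζ ^ ((i : ℕ) - 1))) • fderiv ℂ f ζ := hW.fderiv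
  rw [hW', ContinuousLinearMap.ext_iff, ContinuousLinearMap.ext_iff]
  exact forall_congr' fun v => mul_eq_zero.trans (or_iff_right hne)
end

section
/- Let D ⊆ ℂ^n be a bounded open set and f : D → ℂ a holomorphic function. Let cr_1, …, cr_N ∈ D be critical points of f whose critical values f(cr_1), …, f(cr_N) are pairwise distinct. For Q ∈ ℂ^N and ζ ∈ D set 𝒲(Q, ζ) := f(ζ) + Σ_{i=0}^{N−1} Q_i·f(ζ)^i. Let U ⊆ ℂ^l be an open set containing a point P̄, and let W : U × D → ℂ, 𝒬 : U → ℂ^N and ζ : U × D → D be holomorphic maps satisfying: W(P̄, z) = f(z) for all z ∈ D; 𝒬(P̄) = 0; ζ(P̄, z) = z for all z ∈ D; and W(P, z) = 𝒲(𝒬(P), ζ(P, z)) for all (P, z) ∈ U × D. If the l vectors u_k := (∂W/∂P_k(P̄, cr_1), …, ∂W/∂P_k(P̄, cr_N)) ∈ ℂ^N, for k = 1, …, l, are linearly independent over ℂ, then the derivative of 𝒬 at P̄ is an injective linear map ℂ^l → ℂ^N. -/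
/-- If `Q` vanishes at `P₀` and `g` has derivative zero there, then `g + ∑ i, Q i * g ^ i` has
derivative `∑ i, g P₀ ^ i • dQ i` at `P₀`. -/
theorem hasFDerivAt_add_sum_mul_pow {E : Type*} [NormedAddCommGroup E] [NormedSpace ℂ E] {N : ℕ}
    {Q : E → Fin N → ℂ} {Q' : E →L[ℂ] (Fin N → ℂ)} {g : E → ℂ} {P₀ : E}
    (hQ : HasFDerivAt Q Q' P₀) (hQ0 : Q P₀ = 0) (hg : HasFDerivAt g (0 : E →L[ℂ] ℂ) P₀) :
    HasFDerivAt (fun P => g P + ∑ i : Fin N, Q P i * g P ^ (i : ℕ))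
      (∑ i : Fin N, g P₀ ^ (i : ℕ) • (ContinuousLinearMap.proj i).comp Q') P₀ := by
  have hterm (i : Fin N) : HasFDerivAt (fun P => Q P i * g P ^ (i : ℕ))
      (g P₀ ^ (i : ℕ) • (ContinuousLinearMap.proj i).comp Q') P₀ := by
    refine ((hasFDerivAt_pi'.1 hQ i).mul (hg.pow (i : ℕ))).congr_fderiv ?_
    ext x
    simp [hQ0]
  exact (hg.fun_add (HasFDerivAt.fun_sum fun i _ => hterm i)).congr_fderiv (zero_add _)

/-- Proposition 4.7: let `f` be holomorphic on a bounded open set `D ⊆ ℂⁿ`, with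
critical points `cr 1, …, cr N` having pairwise distinct critical values.  Suppose
`W(P,z) = 𝒲(𝒬(P), ζ(P,z))` where `𝒲(Q,ζ) = f(ζ) + ∑_{i<N} Q_i f(ζ)^i` is the
universal unfolding, `W(P̄,·) = f`, `𝒬(P̄) = 0` and `ζ(P̄,·) = id`.  If the vectors
`u_k = (∂W/∂P_k(P̄, cr_j))_j` are linearly independent, then the derivative of `𝒬`
at `P̄` is injective. -/
theorem unfolding_parameter_map_injective (n N l : ℕ)
    (D : Set (Fin n → ℂ)) (hDopen : IsOpen D) (hDbdd : Bornology.IsBounded D)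
    (f : (Fin n → ℂ) → ℂ) (hf : DifferentiableOn ℂ f D)
    (cr : Fin N → (Fin n → ℂ)) (hcrD : ∀ j, cr j ∈ D)
    (hcrit : ∀ j, fderiv ℂ f (cr j) = 0)
    (hdistinct : ∀ j j' : Fin N, j ≠ j' → f (cr j) ≠ f (cr j'))
    (U : Set (Fin l → ℂ)) (hUopen : IsOpen U)
    (Pbar : Fin l → ℂ) (hPbar : Pbar ∈ U)
    (W : (Fin l → ℂ) × (Fin n → ℂ) → ℂ) (hW : DifferentiableOn ℂ W (U ×ˢ D))
    (Q : (Fin l → ℂ) → (Fin N → ℂ)) (hQ : DifferentiableOn ℂ Q U)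
    (ζ : (Fin l → ℂ) × (Fin n → ℂ) → (Fin n → ℂ))
    (hζ : DifferentiableOn ℂ ζ (U ×ˢ D))
    (hζD : ∀ P ∈ U, ∀ z ∈ D, ζ (P, z) ∈ D)
    (hWf : ∀ z ∈ D, W (Pbar, z) = f z)
    (hQ0 : Q Pbar = 0)
    (hζid : ∀ z ∈ D, ζ (Pbar, z) = z)
    (hfactor : ∀ P ∈ U, ∀ z ∈ D,
      W (P, z) = f (ζ (P, z)) + ∑ i : Fin N, Q P i * (f (ζ (P, z))) ^ (i : ℕ))
    (hli : LinearIndependent ℂ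
      (fun k : Fin l => fun j : Fin N =>
        fderiv ℂ (fun P => W (P, cr j)) Pbar (Pi.single k 1))) :
    Function.Injective (fderiv ℂ Q Pbar) := by
  have hQ' : HasFDerivAt Q (fderiv ℂ Q Pbar) Pbar :=
    (hQ.differentiableAt (hUopen.mem_nhds hPbar)).hasFDerivAt
  have hfζ (j : Fin N) :
      HasFDerivAt (fun P => f (ζ (P, cr j))) (0 : (Fin l → ℂ) →L[ℂ] ℂ) Pbar := by
    have hζ' : DifferentiableAt ℂ (fun P => ζ (P, cr j)) Pbar :=
      (hζ.differentiableAt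
        ((hUopen.prod hDopen).mem_nhds (Set.mk_mem_prod hPbar (hcrD j)))).comp Pbar
        (differentiableAt_id.prodMk (differentiableAt_const _))
    have hf' : HasFDerivAt f (0 : (Fin n → ℂ) →L[ℂ] ℂ) (ζ (Pbar, cr j)) := by
      rw [hζid _ (hcrD j), ← hcrit j]
      exact (hf.differentiableAt (hDopen.mem_nhds (hcrD j))).hasFDerivAt
    exact (hf'.comp Pbar hζ'.hasFDerivAt).congr_fderiv (ContinuousLinearMap.zero_comp _)
  have hW' (j : Fin N) :=
    ((hasFDerivAt_add_sum_mul_pow hQ' hQ0 (hfζ j)).congr_of_eventuallyEq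
      (Filter.eventually_of_mem (hUopen.mem_nhds hPbar)
        fun P hP => hfactor P hP (cr j) (hcrD j))).fderiv
  rw [injective_iff_map_eq_zero]
  intro v hv
  refine funext (Fintype.linearIndependent_iff.1 hli v (funext fun j => ?_))
  have hzero : fderiv ℂ (fun P => W (P, cr j)) Pbar v = 0 := by
    rw [hW' j]
    simp [hv]
  rw [pi_eq_sum_univ' v, map_sum] at hzero
  simpa using hzero
end

section
/- Let D ⊆ ℂ^n be open and let f : D → ℂ be a holomorphic function whose critical points are isolated, i.e., every critical point of f has a neighborhood containing no other critical point of f. For Q ∈ ℂ^N and ζ ∈ D set 𝒲(Q, ζ) := f(ζ) + Σ_{i=0}^{N−1} Q_i·f(ζ)^i. Let Δ ⊆ ℂ^l be a connected open set containing a point P̄, and let 𝒬 : Δ → ℂ^N and ζ : Δ × D → D be continuous maps such that: (i) for each P ∈ Δ the map z ↦ ζ(P, z) is holomorphic and its derivative ∂ζ/∂z(P, z) : ℂ^n → ℂ^n is invertible at every z ∈ D; (ii) ζ(P̄, z) = z for all z ∈ D; (iii) for every P ∈ Δ, the set of critical points in D of the function ζ ↦ 𝒲(𝒬(P), ζ)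 equals the set of critical points of f. Define W(P, z) := 𝒲(𝒬(P), ζ(P, z)), and let cr : Δ → D be a continuous map such that for every P ∈ Δ, cr(P) is a critical point of the function z ↦ W(P, z). Then ζ(P, cr(P)) = cr(P̄) for all P ∈ Δ. -/
/-- If `A` is surjective and the derivative of `g ∘ h` vanishes, where `h` has derivative `A`,
then so does the derivative of `g`. -/
theorem fderiv_eq_zero_of_fderiv_comp_eq_zero {𝕜 E F G : Type*} [NontriviallyNormedField 𝕜]
    [NormedAddCommGroup E] [NormedSpace 𝕜 E] [NormedAddCommGroup F] [NormedSpace 𝕜 F]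
    [NormedAddCommGroup G] [NormedSpace 𝕜 G] {g : F → G} {h : E → F} {x : E}
    (hg : DifferentiableAt 𝕜 g (h x)) (hh : DifferentiableAt 𝕜 h x)
    (hsurj : Function.Surjective (fderiv 𝕜 h x))
    (hcomp : fderiv 𝕜 (fun y => g (h y)) x = 0) : fderiv 𝕜 g (h x) = 0 := by
  rw [fderiv_fun_comp x hg hh] at hcomp
  ext v
  obtain ⟨u, rfl⟩ := hsurj v
  exact congrArg (fun L => L u) hcomp

/-- A set each of whose points has an open neighborhood containing no other point of the set
is discrete. -/
theorem discreteTopology_of_forall_isOpen {X : Type*} [TopologicalSpace X] {S : Set X}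
    (h : ∀ x ∈ S, ∃ V : Set X, IsOpen V ∧ x ∈ V ∧ ∀ y ∈ V ∩ S, y = x) : DiscreteTopology S := by
  refine discreteTopology_iff_isOpen_singleton.2 fun ⟨x, hx⟩ => ?_
  obtain ⟨V, hV, hxV, hVS⟩ := h x hx
  refine ⟨V, hV, ?_⟩
  ext ⟨y, hy⟩
  simp only [Set.mem_preimage, Set.mem_singleton_iff, Subtype.mk.injEq]
  exact ⟨fun hyV => hVS y ⟨hyV, hy⟩, fun hyx => hyx ▸ hxV⟩


/-- Lemma 4.10: continuous families of critical points of the pulled-back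
unfolding `W(P,z) = 𝒲(𝒬(P), ζ(P,z))` are mapped by `ζ` to the corresponding
(fixed) critical point of `f`. -/
theorem critical_family_maps_to_critical_point (n N l : ℕ)
    (D : Set (Fin n → ℂ)) (hDopen : IsOpen D)
    (f : (Fin n → ℂ) → ℂ) (hf : DifferentiableOn ℂ f D)
    (hisolated : ∀ z ∈ D, fderiv ℂ f z = 0 →
      ∃ V : Set (Fin n → ℂ), IsOpen V ∧ z ∈ V ∧
        ∀ w ∈ V ∩ D, fderiv ℂ f w = 0 → w = z)
    (Δ : Set (Fin l → ℂ)) (hΔopen : IsOpen Δ) (hΔconn : IsConnected Δ)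
    (Pbar : Fin l → ℂ) (hPbar : Pbar ∈ Δ)
    (Q : (Fin l → ℂ) → (Fin N → ℂ)) (hQcont : ContinuousOn Q Δ)
    (ζ : (Fin l → ℂ) × (Fin n → ℂ) → (Fin n → ℂ))
    (hζcont : ContinuousOn ζ (Δ ×ˢ D))
    (hζD : ∀ P ∈ Δ, ∀ z ∈ D, ζ (P, z) ∈ D)
    -- (i) each `ζ(P,·)` is holomorphic with invertible derivative everywhere on `D`
    (hζdiff : ∀ P ∈ Δ, DifferentiableOn ℂ (fun z => ζ (P, z)) D)
    (hζinv : ∀ P ∈ Δ, ∀ z ∈ D,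
      Function.Bijective (fderiv ℂ (fun z => ζ (P, z)) z))
    -- (ii) `ζ(P̄,·)` is the identity
    (hζid : ∀ z ∈ D, ζ (Pbar, z) = z)
    -- (iii) for each `P`, `𝒲(𝒬(P),·)` has the same critical points in `D` as `f`
    (hsamecrit : ∀ P ∈ Δ, ∀ z ∈ D,
      (fderiv ℂ (fun w => f w + ∑ i : Fin N, Q P i * (f w) ^ (i : ℕ)) z = 0 ↔
        fderiv ℂ f z = 0))
    -- `cr` is a continuous family of critical points of `W(P,·) = 𝒲(𝒬(P), ζ(P,·))`
    (cr : (Fin l → ℂ) → (Fin n → ℂ)) (hcrcont : ContinuousOn cr Δ)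
    (hcrD : ∀ P ∈ Δ, cr P ∈ D)
    (hcrcrit : ∀ P ∈ Δ,
      fderiv ℂ (fun z =>
        f (ζ (P, z)) + ∑ i : Fin N, Q P i * (f (ζ (P, z))) ^ (i : ℕ)) (cr P) = 0) :
    ∀ P ∈ Δ, ζ (P, cr P) = cr Pbar := by
  have hcrit : Set.MapsTo (fun P => ζ (P, cr P)) Δ {z | z ∈ D ∧ fderiv ℂ f z = 0} := by
    intro P hP
    have hmem := hζD P hP _ (hcrD P hP)
    have hfd := hf.differentiableAt (hDopen.mem_nhds hmem)
    refine ⟨hmem, (hsamecrit P hP _ hmem).1 ?_⟩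
    exact fderiv_eq_zero_of_fderiv_comp_eq_zero
      (g := fun w => f w + ∑ i : Fin N, Q P i * (f w) ^ (i : ℕ)) (h := fun z => ζ (P, z))
      (by fun_prop)
      ((hζdiff P hP).differentiableAt (hDopen.mem_nhds (hcrD P hP)))
      (hζinv P hP _ (hcrD P hP)).surjective (hcrcrit P hP)
  have hdiscrete : DiscreteTopology {z | z ∈ D ∧ fderiv ℂ f z = 0} :=
    discreteTopology_of_forall_isOpen fun z hz => by
      obtain ⟨V, hV, hzV, hVD⟩ := hisolated z hz.1 hz.2
      exact ⟨V, hV, hzV, fun w hw => hVD w ⟨hw.1, hw.2.1⟩ hw.2.2⟩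
  have hcont : ContinuousOn (fun P => ζ (P, cr P)) Δ :=
    hζcont.comp (continuousOn_id.prodMk hcrcont) fun P hP => ⟨hP, hcrD P hP⟩
  intro P hP
  exact (hΔconn.isPreconnected.constant_of_mapsTo ⟨hdiscrete⟩ hcont hcrit hP hPbar).trans
    (hζid _ (hcrD Pbar hPbar))
end
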